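/- Let X be a compact topological space, let a < b be real numbers, and let F : X × ℝ → ℝ be continuous. For β > 0 define G_β : X → ℝ by G_β(x) := β⁻¹ · log(∫_{λ ∈ [a,b]} exp(β · F(x,λ)) dλ), the integral being with respect to Lebesgue measure on [a,b]. Then, as β → ∞, the functions G_β converge uniformly on X to the function x ↦ sup_{λ ∈ [a,b]} F(x,λ). -/

import Mathlib

open MeasureTheory Filter

lemma aux_equi {X : Type*} [TopologicalSpace X] [CompactSpace X]
    (a b : ℝ) (F : X × ℝ → ℝ) (hF : Continuous F) (ε : ℝ) (hε : 0 < ε) :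
    ∃ δ > 0, ∀ x : X, ∀ l ∈ Set.Icc a b, ∀ m ∈ Set.Icc a b, |l - m| < δ →
      |F (x, l) - F (x, m)| < ε := by
  let G : C(ℝ × X, ℝ) := ⟨fun p => F (p.2, p.1), by fun_prop⟩
  have hu : UniformContinuousOn G.curry (Set.Icc a b) :=
    isCompact_Icc.uniformContinuousOn_of_continuous G.curry.continuous.continuousOn
  obtain ⟨δ, hδ, h⟩ := Metric.uniformContinuousOn_iff.1 hu ε hε
  refine ⟨δ, hδ, fun x l hl m hm hlm => ?_⟩
  have h1 := h l hl m hm (by rwa [Real.dist_eq])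
  exact lt_of_le_of_lt (ContinuousMap.dist_apply_le_dist (f := G.curry l) (g := G.curry m) x) h1

lemma aux_bounds (a b : ℝ) (hab : a < b) (f : ℝ → ℝ) (hf : Continuous f)
    (l₀ : ℝ) (hl₀ : l₀ ∈ Set.Icc a b) (hmax : ∀ l ∈ Set.Icc a b, f l ≤ f l₀)
    (ε h β : ℝ) (hh : 0 < h) (hhab : 2 * h ≤ b - a) (hβ : 0 < β)
    (hc : ∀ l ∈ Set.Icc a b, |l - l₀| ≤ h → f l₀ - ε ≤ f l) :
    f l₀ - ε + β⁻¹ * Real.log h ≤ β⁻¹ * Real.log (∫ l in Set.Icc a b, Real.exp (β * f l)) ∧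
    β⁻¹ * Real.log (∫ l in Set.Icc a b, Real.exp (β * f l)) ≤
      f l₀ + β⁻¹ * Real.log (b - a) := by
  have hcont : Continuous fun l => Real.exp (β * f l) := by fun_prop
  have hint : ∀ c d : ℝ, IntegrableOn (fun l => Real.exp (β * f l)) (Set.Icc c d) :=
    fun c d => hcont.continuousOn.integrableOn_Icc
  have hup : ∫ l in Set.Icc a b, Real.exp (β * f l) ≤ (b - a) * Real.exp (β * f l₀) := by
    have := setIntegral_mono_on (μ := volume) (hint a b)
      (g := fun _ => Real.exp (β * f l₀)) (continuousOn_const.integrableOn_Icc)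
      measurableSet_Icc (fun l hl => by
        have := hmax l hl
        gcongr)
    simpa [hab.le] using this
  have hlow : h * Real.exp (β * (f l₀ - ε)) ≤ ∫ l in Set.Icc a b, Real.exp (β * f l) := by
    obtain ⟨c, hca, hcb, hcc⟩ : ∃ c, a ≤ c ∧ c + h ≤ b ∧
        ∀ l ∈ Set.Icc c (c + h), |l - l₀| ≤ h := by
      by_cases hb : l₀ + h ≤ b
      · refine ⟨l₀, hl₀.1, hb, fun l hl => ?_⟩
        rw [abs_le]; constructor <;> linarith [hl.1, hl.2]
      · refine ⟨l₀ - h, by linarith, by linarith [hl₀.2], fun l hl => ?_⟩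
        rw [abs_le]; constructor <;> linarith [hl.1, hl.2]
    have hsub : Set.Icc c (c + h) ⊆ Set.Icc a b := Set.Icc_subset_Icc hca hcb
    have h1 := setIntegral_mono_on (μ := volume)
      (f := fun _ => Real.exp (β * (f l₀ - ε))) (continuousOn_const.integrableOn_Icc)
      (hint c (c + h))
      measurableSet_Icc (fun l hl => by
        have := hc l (hsub hl) (hcc l hl)
        gcongr)
    have h2 := setIntegral_mono_set (μ := volume) (hint a b)
      (Eventually.of_forall fun l => (Real.exp_pos _).le) hsub.eventuallyLE
    refine le_trans ?_ h2
    simpa [hh.le] using h1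
  have hpos : 0 < h * Real.exp (β * (f l₀ - ε)) := by positivity
  have h3 := Real.log_le_log hpos hlow
  have h4 := Real.log_le_log (hpos.trans_le hlow) hup
  rw [Real.log_mul hh.ne' (Real.exp_pos _).ne', Real.log_exp] at h3
  rw [Real.log_mul (by linarith) (Real.exp_pos _).ne', Real.log_exp] at h4
  have hi : 0 ≤ β⁻¹ := by positivity
  have h5 := mul_le_mul_of_nonneg_left h3 hi
  have h6 := mul_le_mul_of_nonneg_left h4 hi
  rw [mul_add, inv_mul_cancel_left₀ hβ.ne'] at h5 h6
  constructor <;> linarith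

/-- For a compact space `X`, reals `a < b`, and a continuous `F : X × ℝ → ℝ`, the
functions `G_β(x) := β⁻¹ * log ∫_{[a,b]} exp (β * F (x, λ)) dλ` converge uniformly on `X`,
as `β → ∞`, to `x ↦ sup_{λ ∈ [a,b]} F (x, λ)`. -/
theorem stmt0 {X : Type*} [TopologicalSpace X] [CompactSpace X]
    (a b : ℝ) (hab : a < b) (F : X × ℝ → ℝ) (hF : Continuous F) :
    TendstoUniformly
      (fun (β : ℝ) (x : X) =>
        β⁻¹ * Real.log (∫ l in Set.Icc a b, Real.exp (β * F (x, l))))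
      (fun x => ⨆ l : Set.Icc a b, F (x, (l : ℝ)))
      atTop := by
  rw [Metric.tendstoUniformly_iff]
  intro ε hε
  obtain ⟨δ, hδ, hδ'⟩ := aux_equi a b F hF (ε / 2) (by linarith)
  obtain ⟨h, hh, hhδ, hhab⟩ : ∃ h : ℝ, 0 < h ∧ h < δ ∧ 2 * h ≤ b - a :=
    ⟨min δ (b - a) / 2, by have := lt_min hδ (sub_pos.2 hab); linarith,
      by have := min_le_left δ (b - a); linarith,
      by have := min_le_right δ (b - a); linarith⟩
  have ht : ∀ c : ℝ, Tendsto (fun β : ℝ => β⁻¹ * c) atTop (nhds 0) := fun c => by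
    simpa using tendsto_inv_atTop_zero.mul_const c
  filter_upwards [eventually_gt_atTop 0,
    (ht (Real.log h)).eventually (lt_mem_nhds (show -(ε / 2) < 0 by linarith)),
    (ht (Real.log (b - a))).eventually (gt_mem_nhds hε)] with β hβ h1 h2 x
  have hc : Continuous fun l => F (x, l) := by fun_prop
  obtain ⟨l₀, hl₀, hmax⟩ := isCompact_Icc.exists_isMaxOn (Set.nonempty_Icc.2 hab.le) hc.continuousOn
  have hmax' : ∀ l ∈ Set.Icc a b, F (x, l) ≤ F (x, l₀) := fun l hl => hmax hl
  have hsup : (⨆ l : Set.Icc a b, F (x, (l : ℝ))) = F (x, l₀) := by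
    haveI : Nonempty (Set.Icc a b) := ⟨⟨l₀, hl₀⟩⟩
    apply le_antisymm
    · exact ciSup_le fun l => hmax' l l.2
    · exact le_ciSup (f := fun l : Set.Icc a b => F (x, (l : ℝ)))
        ⟨F (x, l₀), by rintro _ ⟨l, rfl⟩; exact hmax' l l.2⟩ ⟨l₀, hl₀⟩
  have hb := aux_bounds a b hab (fun l => F (x, l)) hc l₀ hl₀ hmax' (ε / 2) h β hh hhab hβ
    (fun l hl hll => by
      have := abs_lt.1 (hδ' x l hl l₀ hl₀ (by linarith))
      linarith [this.1])
  rw [hsup, Real.dist_eq, abs_lt]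
  constructor <;> linarith [hb.1, hb.2]
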